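/- Let P be a two-color grid poset with the max property and let L := J_color(P). Suppose L is M-structured for M = [[2,−1],[−2,2]]. Write (a,b) := wt(max). Then a ≥ 0 and b ≥ 0, the polynomial RGF(L,q) is symmetric and unimodal, and RGF(L,q)·(1−q)·(1−q)·(1−q²)·(1−q³) = (1−q^{a+1})(1−q^{b+1})(1−q^{a+b+2})(1−q^{a+2b+3}) in ℤ[q]. -/

import Mathlib

open scoped Classical

structure GridData (P : Type) [PartialOrder P] where
  m : ℕ
  chain : P → ℕ
  color : P → Fin 2

def IsIdeal {P : Type} [PartialOrder P] (t : Finset P) : Prop :=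
  ∀ ⦃x⦄, x ∈ t → ∀ ⦃y⦄, y ≤ x → y ∈ t

namespace GridData

variable {P : Type} [PartialOrder P] [Fintype P]

/-- The defining properties of a grid poset. -/
def IsGridPoset (G : GridData P) : Prop :=
  1 ≤ G.m ∧
  (∀ u : P, G.chain u ∈ Finset.Icc 1 G.m) ∧
  (∀ i ∈ Finset.Icc 1 G.m, ∃ u : P, G.chain u = i) ∧
  (∀ u v : P, G.chain u = G.chain v → u ≤ v ∨ v ≤ u) ∧
  (∀ u v : P, u ⋖ v → G.chain u = G.chain v ∨ G.chain u = G.chain v + 1)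

/-- The defining properties of a two-color grid poset. -/
def IsTwoColorGridPoset (G : GridData P) : Prop :=
  G.IsGridPoset ∧
  (∀ u v : P, G.chain u = G.chain v → G.color u = G.color v) ∧
  (∀ u v : P, Relation.ReflTransGen (fun x y : P => x ⋖ y ∨ y ⋖ x) u v →
    G.chain u = G.chain v + 1 → G.color u ≠ G.color v)

/-- The max property. -/
def MaxProperty (G : GridData P) : Prop :=
  (∀ u : P, IsMax u → G.chain u ≤ 2) ∧
  (∀ u v : P, IsMax u → IsMax v → u ≠ v → G.color u ≠ G.color v)

/-- The fiber `C i` of the chain function. -/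
def fiber (G : GridData P) (i : ℕ) : Finset P :=
  Finset.univ.filter (fun u => G.chain u = i)

/-- One step in a `γ`-component of `J_color(P)`: add or remove a single vertex of
color `γ` while both sets are order ideals. -/
def GStep (G : GridData P) (γ : Fin 2) (s t : Finset P) : Prop :=
  IsIdeal s ∧ IsIdeal t ∧ ∃ u : P, G.color u = γ ∧
    ((u ∉ s ∧ t = insert u s) ∨ (u ∉ t ∧ s = insert u t))

/-- The `γ`-component of `t` in `J_color(P)`. -/
def comp (G : GridData P) (γ : Fin 2) (t : Finset P) : Set (Finset P) :=
  {s | Relation.ReflTransGen (G.GStep γ) t s}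

noncomputable def minCard (G : GridData P) (γ : Fin 2) (t : Finset P) : ℕ :=
  sInf (Finset.card '' G.comp γ t)

noncomputable def maxCard (G : GridData P) (γ : Fin 2) (t : Finset P) : ℕ :=
  sSup (Finset.card '' G.comp γ t)

/-- `m_γ(t) = 2 ρ_γ(t) - l_γ(t)`. -/
noncomputable def mcoord (G : GridData P) (γ : Fin 2) (t : Finset P) : ℤ :=
  2 * ((t.card : ℤ) - (G.minCard γ t : ℤ)) - ((G.maxCard γ t : ℤ) - (G.minCard γ t : ℤ))

/-- The weight of an element of `J_color(P)` (color `0` is α, color `1` is β). -/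
noncomputable def wt (G : GridData P) (t : Finset P) : Fin 2 → ℤ :=
  ![G.mcoord 0 t, G.mcoord 1 t]

/-- `J_color(P)` is `M`-structured. -/
def MStructured (G : GridData P) (M : Matrix (Fin 2) (Fin 2) ℤ) : Prop :=
  ∀ s t : Finset P, IsIdeal s → IsIdeal t → ∀ u : P, u ∉ s → t = insert u s →
    G.wt s + M (G.color u) = G.wt t

end GridData

open Polynomial in
/-- The rank generating function of the lattice of order ideals of P. -/
noncomputable def RGF (P : Type) [PartialOrder P] [Fintype P] : Polynomial ℤ :=
  ∑ t ∈ Finset.univ.filter (fun t : Finset P => IsIdeal t), X ^ t.card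

/-- A polynomial `a_0 + a_1 q + ⋯ + a_l q^l` is symmetric if `a_i = a_{l-i}`. -/
def PolySymmetric (p : Polynomial ℤ) : Prop :=
  ∀ i ≤ p.natDegree, p.coeff i = p.coeff (p.natDegree - i)

/-- A polynomial is unimodal if its coefficients increase up to some index `k` and
decrease thereafter. -/
def PolyUnimodal (p : Polynomial ℤ) : Prop :=
  ∃ k, (∀ i j, i ≤ j → j ≤ k → p.coeff i ≤ p.coeff j) ∧
    (∀ i j, k ≤ i → i ≤ j → j ≤ p.natDegree → p.coeff j ≤ p.coeff i)

set_option linter.unusedSectionVars false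

namespace GridData

variable {P : Type} [PartialOrder P] [Fintype P]

/-- The smallest ideal with the same non-`γ` part as `t`. -/
noncomputable def tmin (G : GridData P) (γ : Fin 2) (t : Finset P) : Finset P :=
  Finset.univ.filter (fun u => ∃ v, u ≤ v ∧ G.color v ≠ γ ∧ v ∈ t)

/-- The largest ideal with the same non-`γ` part as `t`. -/
noncomputable def tmax (G : GridData P) (γ : Fin 2) (t : Finset P) : Finset P :=
  Finset.univ.filter (fun u => ∀ w, w ≤ u → G.color w ≠ γ → w ∈ t)

/-- Two sets have the same non-`γ` part. -/
def Same (G : GridData P) (γ : Fin 2) (s t : Finset P) : Prop :=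
  ∀ u, G.color u ≠ γ → (u ∈ s ↔ u ∈ t)

noncomputable def cnt (G : GridData P) (k : ℕ) (t : Finset P) : ℕ :=
  (t.filter (fun u => G.chain u = k)).card

noncomputable def pos (G : GridData P) (u : P) : ℕ :=
  (Finset.univ.filter (fun v => v < u ∧ G.chain v = G.chain u)).card

noncomputable def build (G : GridData P) (d : ℕ → ℕ) : Finset P :=
  Finset.univ.filter (fun u => G.pos u < d (G.chain u))

theorem le_iff_rtg (x y : P) : x ≤ y ↔ Relation.ReflTransGen (· ⋖ ·) x y := by
  let _ : LocallyFiniteOrder P := Fintype.toLocallyFiniteOrder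
  exact le_iff_reflTransGen_covBy

theorem Same.symm {G : GridData P} {γ : Fin 2} {s t : Finset P} (h : G.Same γ s t) :
    G.Same γ t s := fun u hu => (h u hu).symm

theorem Same.trans {G : GridData P} {γ : Fin 2} {s t r : Finset P} (h : G.Same γ s t)
    (h' : G.Same γ t r) : G.Same γ s r := fun u hu => (h u hu).trans (h' u hu)

theorem tmin_congr {G : GridData P} {γ : Fin 2} {s t : Finset P} (h : G.Same γ s t) :
    G.tmin γ s = G.tmin γ t := by
  unfold tmin
  congr 1
  funext u
  exact propext ⟨fun ⟨v, a, b, c⟩ => ⟨v, a, b, (h v b).1 c⟩,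
    fun ⟨v, a, b, c⟩ => ⟨v, a, b, (h v b).2 c⟩⟩

theorem tmax_congr {G : GridData P} {γ : Fin 2} {s t : Finset P} (h : G.Same γ s t) :
    G.tmax γ s = G.tmax γ t := by
  unfold tmax
  congr 1
  funext u
  exact propext ⟨fun H w a b => (h w b).1 (H w a b), fun H w a b => (h w b).2 (H w a b)⟩

theorem tmin_sub {G : GridData P} {γ : Fin 2} {t : Finset P} (ht : IsIdeal t) :
    G.tmin γ t ⊆ t := by
  intro u hu
  simp only [tmin, Finset.mem_filter, Finset.mem_univ, true_and] at hu
  obtain ⟨v, a, b, c⟩ := hu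
  exact ht c a

theorem sub_tmax {G : GridData P} {γ : Fin 2} {t : Finset P} (ht : IsIdeal t) :
    t ⊆ G.tmax γ t := by
  intro u hu
  simp only [tmax, Finset.mem_filter, Finset.mem_univ, true_and]
  exact fun w hw _ => ht hu hw

theorem tmin_ideal (G : GridData P) (γ : Fin 2) (t : Finset P) : IsIdeal (G.tmin γ t) := by
  intro x hx y hy
  simp only [tmin, Finset.mem_filter, Finset.mem_univ, true_and] at hx ⊢
  obtain ⟨v, a, b, c⟩ := hx
  exact ⟨v, hy.trans a, b, c⟩

theorem tmax_ideal (G : GridData P) (γ : Fin 2) (t : Finset P) : IsIdeal (G.tmax γ t) := by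
  intro x hx y hy
  simp only [tmax, Finset.mem_filter, Finset.mem_univ, true_and] at hx ⊢
  exact fun w hw h => hx w (hw.trans hy) h

theorem same_of_between {G : GridData P} {γ : Fin 2} {t s : Finset P}
    (h1 : G.tmin γ t ⊆ s) (h2 : s ⊆ G.tmax γ t) : G.Same γ s t := by
  intro u hu
  constructor
  · intro h
    have := h2 h
    simp only [tmax, Finset.mem_filter, Finset.mem_univ, true_and] at this
    exact this u le_rfl hu
  · intro h
    apply h1
    simp only [tmin, Finset.mem_filter, Finset.mem_univ, true_and]
    exact ⟨u, le_rfl, hu, h⟩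

theorem same_tmin {G : GridData P} {γ : Fin 2} {t : Finset P} (ht : IsIdeal t) :
    G.Same γ (G.tmin γ t) t :=
  same_of_between (fun _ h => h) ((tmin_sub ht).trans (sub_tmax ht))

theorem same_tmax {G : GridData P} {γ : Fin 2} {t : Finset P} (ht : IsIdeal t) :
    G.Same γ (G.tmax γ t) t :=
  same_of_between ((tmin_sub ht).trans (sub_tmax ht)) (fun _ h => h)

theorem comp_sub {G : GridData P} {γ : Fin 2} {t s : Finset P} (ht : IsIdeal t)
    (h : s ∈ G.comp γ t) : IsIdeal s ∧ G.Same γ s t := by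
  change Relation.ReflTransGen (G.GStep γ) t s at h
  induction h with
  | refl => exact ⟨ht, fun _ _ => Iff.rfl⟩
  | tail _ h2 ih =>
    obtain ⟨i1, i2⟩ := ih
    obtain ⟨a1, a2, u, hu, h | h⟩ := h2
    · refine ⟨a2, Same.trans ?_ i2⟩
      intro v hv
      have : v ≠ u := by rintro rfl; exact hv hu
      simp [h.2, this]
    · refine ⟨a2, Same.trans ?_ i2⟩
      intro v hv
      have : v ≠ u := by rintro rfl; exact hv hu
      simp [h.2, this]

theorem GStep_symm {G : GridData P} {γ : Fin 2} {t s : Finset P} (h : G.GStep γ s t) :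
    G.GStep γ t s := by
  obtain ⟨a, b, u, c, d⟩ := h
  exact ⟨b, a, u, c, d.symm⟩

theorem down_path {G : GridData P} {γ : Fin 2} {s : Finset P} (hs : IsIdeal s) (n : ℕ) :
    ∀ t : Finset P, IsIdeal t → s ⊆ t → (t \ s).card = n → G.Same γ s t →
      Relation.ReflTransGen (G.GStep γ) t s := by
  induction n with
  | zero =>
    intro t ht hst hc _
    have : t ⊆ s := by
      rw [Finset.card_eq_zero, Finset.sdiff_eq_empty_iff_subset] at hc
      exact hc
    rw [Finset.Subset.antisymm hst this]
  | succ n ih =>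
    intro t ht hst hc hS
    have hne : (t \ s).Nonempty := by
      rw [← Finset.card_pos]; omega
    obtain ⟨u, hu⟩ := Finset.exists_maximal hne
    have hut : u ∈ t := (Finset.mem_sdiff.1 hu.1).1
    have hus : u ∉ s := (Finset.mem_sdiff.1 hu.1).2
    have hcol : G.color u = γ := by
      by_contra h
      exact hus ((hS u h).2 hut)
    have hid : IsIdeal (t.erase u) := by
      intro x hx y hy
      rw [Finset.mem_erase] at hx ⊢
      refine ⟨?_, ht hx.2 hy⟩
      rintro rfl
      have hxs : x ∉ s := fun h => hus (hs h hy)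
      exact hx.1 (le_antisymm (hu.2 (Finset.mem_sdiff.2 ⟨hx.2, hxs⟩) hy) hy)
    have hstep : G.GStep γ t (t.erase u) :=
      ⟨ht, hid, u, hcol, Or.inr ⟨by simp, by rw [Finset.insert_erase hut]⟩⟩
    refine Relation.ReflTransGen.head hstep (ih _ hid ?_ ?_ ?_)
    · intro x hx
      rw [Finset.mem_erase]
      exact ⟨by rintro rfl; exact hus hx, hst hx⟩
    · have : (t.erase u) \ s = (t \ s).erase u := by
        ext x; simp only [Finset.mem_sdiff, Finset.mem_erase]; tauto
      rw [this, Finset.card_erase_of_mem hu.1]; omega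
    · intro v hv
      have : v ≠ u := by rintro rfl; exact hv hcol
      simp [hS v hv, this]

theorem mem_comp {G : GridData P} {γ : Fin 2} {t s : Finset P} (ht : IsIdeal t)
    (hs : IsIdeal s) (h : G.Same γ s t) : s ∈ G.comp γ t := by
  change Relation.ReflTransGen (G.GStep γ) t s
  have hm := tmin_ideal G γ t
  have h1 : Relation.ReflTransGen (G.GStep γ) t (G.tmin γ t) :=
    down_path hm _ t ht (tmin_sub ht) rfl (same_tmin ht)
  have h2 : Relation.ReflTransGen (G.GStep γ) s (G.tmin γ t) :=
    down_path hm _ s hs (by rw [← tmin_congr h]; exact tmin_sub hs) rfl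
      ((same_tmin ht).trans h.symm)
  refine h1.trans ?_
  have hs : Std.Symm (G.GStep γ) := ⟨fun _ _ h => GStep_symm h⟩
  exact (Relation.ReflTransGen.stdSymm (r := G.GStep γ)).symm _ _ h2

theorem minCard_eq {G : GridData P} {γ : Fin 2} {t : Finset P} (ht : IsIdeal t) :
    G.minCard γ t = (G.tmin γ t).card := by
  unfold minCard
  apply IsLeast.csInf_eq
  constructor
  · exact ⟨_, mem_comp ht (tmin_ideal G γ t) (same_tmin ht), rfl⟩
  · rintro _ ⟨s, hs, rfl⟩
    obtain ⟨a, b⟩ := comp_sub ht hs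
    rw [← tmin_congr b]
    exact Finset.card_le_card (tmin_sub a)

theorem maxCard_eq {G : GridData P} {γ : Fin 2} {t : Finset P} (ht : IsIdeal t) :
    G.maxCard γ t = (G.tmax γ t).card := by
  unfold maxCard
  apply IsGreatest.csSup_eq
  constructor
  · exact ⟨_, mem_comp ht (tmax_ideal G γ t) (same_tmax ht), rfl⟩
  · rintro _ ⟨s, hs, rfl⟩
    obtain ⟨a, b⟩ := comp_sub ht hs
    rw [← tmax_congr b]
    exact Finset.card_le_card (sub_tmax a)

theorem mcoord_eq {G : GridData P} {γ : Fin 2} {t : Finset P} (ht : IsIdeal t) :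
    G.mcoord γ t = 2 * (t.card : ℤ) - (G.tmin γ t).card - (G.tmax γ t).card := by
  unfold mcoord
  rw [minCard_eq ht, maxCard_eq ht]; ring

theorem wt_comp {G : GridData P} {M : Matrix (Fin 2) (Fin 2) ℤ} (hM : G.MStructured M)
    {γ : Fin 2} {t s : Finset P} (h : s ∈ G.comp γ t) :
    G.wt s = G.wt t + ((s.card : ℤ) - t.card) • M γ := by
  change Relation.ReflTransGen (G.GStep γ) t s at h
  induction h with
  | refl => simp
  | @tail r q _ h2 ih =>
    obtain ⟨a1, a2, u, hu, h | h⟩ := h2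
    · have := hM r q a1 a2 u h.1 h.2
      rw [← this, ih, hu, h.2, Finset.card_insert_of_notMem h.1]
      push_cast
      module
    · have := hM q r a2 a1 u h.1 h.2
      rw [hu, ih] at this
      rw [eq_sub_of_add_eq this, h.2, Finset.card_insert_of_notMem h.1]
      push_cast
      module

/-! Positions in chains -/

theorem pos_lt_pos {G : GridData P} {u v : P} (h : u < v) (hc : G.chain u = G.chain v) :
    G.pos u < G.pos v := by
  unfold pos
  apply Finset.card_lt_card
  rw [Finset.ssubset_iff_of_subset]
  · exact ⟨u, by simp [h, hc], by simp⟩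
  · intro w hw
    simp only [Finset.mem_filter, Finset.mem_univ, true_and] at hw ⊢
    exact ⟨hw.1.trans h, hw.2.trans hc⟩

theorem cnt_build {G : GridData P} (hG : G.IsGridPoset) {d : ℕ → ℕ} {k : ℕ}
    (hd : d k ≤ G.cnt k Finset.univ) : G.cnt k (G.build d) = d k := by
  obtain ⟨_, _, _, hch, _⟩ := hG
  have hinj : Set.InjOn G.pos (Finset.univ.filter (fun u => G.chain u = k) : Finset P) := by
    intro u hu v hv h
    simp only [Finset.coe_filter, Finset.mem_univ, true_and, Set.mem_ofPred_eq] at hu hv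
    by_contra hne
    rcases hch u v (hu.trans hv.symm) with h1 | h1
    · have := pos_lt_pos (G := G) (lt_of_le_of_ne h1 hne) (hu.trans hv.symm); omega
    · have := pos_lt_pos (G := G) (lt_of_le_of_ne h1 (Ne.symm hne)) (hv.trans hu.symm); omega
  have hcard : ((Finset.univ.filter (fun u => G.chain u = k)).image G.pos).card
      = G.cnt k Finset.univ := Finset.card_image_of_injOn hinj
  have himg : (Finset.univ.filter (fun u => G.chain u = k)).image G.pos
      = Finset.range (G.cnt k Finset.univ) := by
    apply Finset.eq_of_subset_of_card_le
    · intro x hx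
      simp only [Finset.mem_image, Finset.mem_filter, Finset.mem_univ, true_and] at hx
      obtain ⟨u, hu, rfl⟩ := hx
      rw [Finset.mem_range]
      unfold pos cnt
      apply Finset.card_lt_card
      rw [Finset.ssubset_iff_of_subset]
      · exact ⟨u, by simp [hu], by simp⟩
      · intro w hw
        simp only [Finset.mem_filter, Finset.mem_univ, true_and] at hw ⊢
        exact hw.2.trans hu
    · rw [hcard, Finset.card_range]
  have h2 : ((G.build d).filter (fun u => G.chain u = k)).image G.pos = Finset.range (d k) := by
    ext x
    simp only [Finset.mem_image, Finset.mem_filter, Finset.mem_range, build, Finset.mem_univ,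
      true_and]
    constructor
    · rintro ⟨u, ⟨h1, h2⟩, rfl⟩
      rw [h2] at h1; exact h1
    · intro hx
      have : x ∈ Finset.range (G.cnt k Finset.univ) := Finset.mem_range.2 (by omega)
      rw [← himg] at this
      simp only [Finset.mem_image, Finset.mem_filter, Finset.mem_univ, true_and] at this
      obtain ⟨u, hu, rfl⟩ := this
      exact ⟨u, ⟨by rw [hu]; exact hx, hu⟩, rfl⟩
  have h3 := congrArg Finset.card h2
  rw [Finset.card_range, Finset.card_image_of_injOn] at h3
  · exact h3
  · refine hinj.mono ?_
    intro x hx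
    simp only [Finset.coe_filter, Set.mem_ofPred_eq, Finset.mem_univ, true_and] at hx ⊢
    exact hx.2

theorem mem_iff_pos {G : GridData P} (hG : G.IsGridPoset) {t : Finset P} (ht : IsIdeal t)
    (u : P) : u ∈ t ↔ G.pos u < G.cnt (G.chain u) t := by
  obtain ⟨_, _, _, hch, _⟩ := hG
  constructor
  · intro hu
    unfold pos cnt
    apply Finset.card_lt_card
    rw [Finset.ssubset_iff_of_subset]
    · exact ⟨u, by simp [hu], by simp⟩
    · intro w hw
      simp only [Finset.mem_filter, Finset.mem_univ, true_and] at hw ⊢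
      exact ⟨ht hu hw.1.le, hw.2⟩
  · intro h
    by_contra hu
    refine absurd h (not_lt.2 ?_)
    unfold pos cnt
    apply Finset.card_le_card
    intro w hw
    simp only [Finset.mem_filter, Finset.mem_univ, true_and] at hw ⊢
    refine ⟨?_, hw.2⟩
    rcases hch w u hw.2 with h1 | h1
    · refine lt_of_le_of_ne h1 ?_
      rintro rfl; exact hu hw.1
    · exact absurd (ht hw.1 h1) hu

theorem ext_cnt {G : GridData P} (hG : G.IsGridPoset) {s t : Finset P} (hs : IsIdeal s)
    (ht : IsIdeal t) (h : ∀ k, G.cnt k s = G.cnt k t) : s = t := by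
  ext u
  rw [mem_iff_pos hG hs, mem_iff_pos hG ht, h]

theorem card_eq_sum {G : GridData P} (hG : G.IsGridPoset) (t : Finset P) :
    t.card = ∑ k ∈ Finset.range (G.m + 1), G.cnt k t := by
  apply Finset.card_eq_sum_card_fiberwise
  intro u _
  have := hG.2.1 u
  rw [Finset.mem_Icc] at this
  simp only [Finset.coe_range, Set.mem_Iio]
  omega

theorem chain_of_mono {G : GridData P} (hG : G.IsTwoColorGridPoset) {γ : Fin 2} {x y : P}
    (h : y ≤ x) (hc : ∀ z, y ≤ z → z ≤ x → G.color z = γ) : G.chain y = G.chain x := by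
  rw [le_iff_rtg] at h
  induction h with
  | refl => rfl
  | @tail b c h1 h2 ih =>
    rw [← le_iff_rtg] at h1
    rw [ih (fun z a b => hc z a (b.trans h2.le))]
    rcases hG.1.2.2.2.2 _ _ h2 with h | h
    · exact h
    · exact absurd ((hc b h1 h2.le).trans (hc c (h1.trans h2.le) le_rfl).symm)
        (hG.2.2 b c (Relation.ReflTransGen.single (Or.inl h2)) h)

theorem chain_anti {G : GridData P} (hG : G.IsGridPoset) {x y : P} (h : y ≤ x) :
    G.chain x ≤ G.chain y := by
  rw [le_iff_rtg] at h
  induction h with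
  | refl => rfl
  | @tail b c h1 h2 ih =>
    rcases hG.2.2.2.2 _ _ h2 with h | h <;> omega

theorem build_ideal {G : GridData P} (hG : G.IsTwoColorGridPoset) {γ : Fin 2} {t s : Finset P}
    (h1 : G.tmin γ t ⊆ s) (h2 : s ⊆ G.tmax γ t)
    (hi : ∀ x y, x ∈ s → y ≤ x → G.chain y = G.chain x → y ∈ s) : IsIdeal s := by
  intro x hx y hy
  by_cases hc : ∃ z, y ≤ z ∧ z ≤ x ∧ G.color z ≠ γ
  · obtain ⟨z, a, b, c⟩ := hc
    have hz := h2 hx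
    simp only [tmax, Finset.mem_filter, Finset.mem_univ, true_and] at hz
    apply h1
    simp only [tmin, Finset.mem_filter, Finset.mem_univ, true_and]
    exact ⟨z, a, c, hz z b c⟩
  · push Not at hc
    exact hi x y hx hy (chain_of_mono hG hy hc)

theorem build_spec {G : GridData P} (hG : G.IsTwoColorGridPoset) {γ : Fin 2} {t : Finset P}
    (ht : IsIdeal t) {d : ℕ → ℕ} (hd1 : ∀ k, G.cnt k (G.tmin γ t) ≤ d k)
    (hd2 : ∀ k, d k ≤ G.cnt k (G.tmax γ t)) :
    IsIdeal (G.build d) ∧ G.Same γ (G.build d) t ∧ ∀ k, G.cnt k (G.build d) = d k := by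
  have h1 : G.tmin γ t ⊆ G.build d := by
    intro u hu
    rw [mem_iff_pos hG.1 (tmin_ideal G γ t)] at hu
    simp only [build, Finset.mem_filter, Finset.mem_univ, true_and]
    exact hu.trans_le (hd1 _)
  have h2 : G.build d ⊆ G.tmax γ t := by
    intro u hu
    rw [mem_iff_pos hG.1 (tmax_ideal G γ t)]
    simp only [build, Finset.mem_filter, Finset.mem_univ, true_and] at hu
    exact hu.trans_le (hd2 _)
  refine ⟨build_ideal hG h1 h2 ?_, same_of_between h1 h2, ?_⟩
  · intro x y hx hy hc
    simp only [build, Finset.mem_filter, Finset.mem_univ, true_and] at hx ⊢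
    rcases hy.eq_or_lt with rfl | h
    · exact hx
    · have := pos_lt_pos h hc
      rw [hc]; omega
  · intro k
    apply cnt_build hG.1
    refine (hd2 k).trans ?_
    unfold cnt
    exact Finset.card_le_card (Finset.filter_subset_filter _ (Finset.subset_univ _))

/-- Reflection of an ideal in its `γ`-component, with a shift `e`. -/
noncomputable def refl (G : GridData P) (γ : Fin 2) (e : ℕ → ℕ) (t : Finset P) : Finset P :=
  G.build (fun k => G.cnt k (G.tmin γ t) + G.cnt k (G.tmax γ t) - e k - G.cnt k t)

theorem cnt_mono (G : GridData P) (k : ℕ) {s t : Finset P} (h : s ⊆ t) :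
    G.cnt k s ≤ G.cnt k t :=
  Finset.card_le_card (Finset.filter_subset_filter _ h)

theorem refl_spec {G : GridData P} (hG : G.IsTwoColorGridPoset) {γ : Fin 2} {t : Finset P}
    (ht : IsIdeal t) {e : ℕ → ℕ} (he : ∀ k, e k + G.cnt k t ≤ G.cnt k (G.tmax γ t)) :
    IsIdeal (G.refl γ e t) ∧ G.Same γ (G.refl γ e t) t ∧
      (∀ k, G.cnt k (G.refl γ e t) + e k + G.cnt k t =
        G.cnt k (G.tmin γ t) + G.cnt k (G.tmax γ t)) ∧ G.refl γ e (G.refl γ e t) = t := by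
  have hA : ∀ k, G.cnt k (G.tmin γ t) ≤ G.cnt k t := fun k => cnt_mono G k (tmin_sub ht)
  obtain ⟨h1, h2, h3⟩ := build_spec hG (γ := γ) ht
    (d := fun k => G.cnt k (G.tmin γ t) + G.cnt k (G.tmax γ t) - e k - G.cnt k t)
    (fun k => by have := he k; have := hA k; omega)
    (fun k => by have := he k; have := hA k; omega)
  change IsIdeal (G.refl γ e t) at h1
  change G.Same γ (G.refl γ e t) t at h2
  change ∀ k, G.cnt k (G.refl γ e t) = _ at h3
  have h4 : ∀ k, G.cnt k (G.refl γ e t) + e k + G.cnt k t =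
        G.cnt k (G.tmin γ t) + G.cnt k (G.tmax γ t) := by
    intro k
    have := he k; have := hA k; have := h3 k
    omega
  refine ⟨h1, h2, h4, ?_⟩
  obtain ⟨g1, g2, g3⟩ := build_spec hG (γ := γ) h1
    (d := fun k => G.cnt k (G.tmin γ (G.refl γ e t)) + G.cnt k (G.tmax γ (G.refl γ e t)) - e k
      - G.cnt k (G.refl γ e t))
    (fun k => by
      rw [tmin_congr h2, tmax_congr h2]
      have := he k; have := hA k; have := h4 k; omega)
    (fun k => by
      rw [tmin_congr h2, tmax_congr h2]
      have := he k; have := hA k; have := h4 k; omega)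
  refine ext_cnt hG.1 g1 ht ?_
  intro k
  have := g3 k
  rw [tmin_congr h2, tmax_congr h2] at this
  have h5 := h4 k
  change G.cnt k (G.build _) = _
  rw [tmin_congr h2, tmax_congr h2, this]
  omega

theorem refl_wt {G : GridData P} (hG : G.IsTwoColorGridPoset) {M : Matrix (Fin 2) (Fin 2) ℤ}
    (hM : G.MStructured M) {γ : Fin 2} {t : Finset P}
    (ht : IsIdeal t) {e : ℕ → ℕ} (he : ∀ k, e k + G.cnt k t ≤ G.cnt k (G.tmax γ t)) :
    G.wt (G.refl γ e t) =
      G.wt t - (G.mcoord γ t + ((∑ k ∈ Finset.range (G.m + 1), e k : ℕ) : ℤ)) • M γ := by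
  obtain ⟨h1, h2, h3, -⟩ := refl_spec hG ht he
  rw [wt_comp hM (mem_comp ht h1 h2), mcoord_eq ht]
  have : (G.refl γ e t).card + (∑ k ∈ Finset.range (G.m + 1), e k) + t.card =
      (G.tmin γ t).card + (G.tmax γ t).card := by
    simp only [card_eq_sum hG.1, ← Finset.sum_add_distrib, h3]
  have h6 : ((G.refl γ e t).card : ℤ) = (G.tmin γ t).card + (G.tmax γ t).card - t.card
      - ((∑ k ∈ Finset.range (G.m + 1), e k : ℕ) : ℤ) := by
    have := congrArg (Nat.cast : ℕ → ℤ) this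
    push_cast at this ⊢
    linarith
  rw [h6]
  module

end GridData
namespace GridData

variable {P : Type} [PartialOrder P] [Fintype P]

/-- The largest index of a chain that is not contained in `t`. -/
noncomputable def topIdx (G : GridData P) (t : Finset P) : ℕ := (Finset.univ \ t).sup G.chain

/-- The color of the chain with index `k`. -/
noncomputable def kap (G : GridData P) (k : ℕ) : Fin 2 :=
  if h : ∃ u, G.chain u = k then G.color h.choose else 0

theorem kap_chain {G : GridData P} (hG : G.IsTwoColorGridPoset) (u : P) :
    G.kap (G.chain u) = G.color u := by
  have h : ∃ v, G.chain v = G.chain u := ⟨u, rfl⟩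
  unfold kap
  rw [dif_pos h]
  exact hG.2.1 _ _ h.choose_spec

theorem topIdx_exists {G : GridData P} {t : Finset P} (ht : t ≠ Finset.univ) :
    ∃ u, u ∉ t ∧ G.chain u = G.topIdx t := by
  have hne : (Finset.univ \ t).Nonempty := by
    rw [Finset.sdiff_nonempty]
    intro h
    exact ht (Finset.univ_subset_iff.1 h)
  obtain ⟨u, hu, h⟩ := Finset.exists_mem_eq_sup _ hne G.chain
  exact ⟨u, (Finset.mem_sdiff.1 hu).2, h.symm⟩

theorem topIdx_full {G : GridData P} {t : Finset P} {u : P} (h : G.topIdx t < G.chain u) :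
    u ∈ t := by
  by_contra hu
  have : G.chain u ≤ G.topIdx t :=
    Finset.le_sup (f := G.chain) (Finset.mem_sdiff.2 ⟨Finset.mem_univ _, hu⟩)
  omega

theorem topIdx_eq {G : GridData P} {t : Finset P} {k : ℕ} (h1 : ∃ u, u ∉ t ∧ G.chain u = k)
    (h2 : ∀ u, k < G.chain u → u ∈ t) : G.topIdx t = k := by
  apply le_antisymm
  · apply Finset.sup_le
    intro u hu
    by_contra h
    exact (Finset.mem_sdiff.1 hu).2 (h2 u (by omega))
  · obtain ⟨u, hu, rfl⟩ := h1
    exact Finset.le_sup (f := G.chain) (Finset.mem_sdiff.2 ⟨Finset.mem_univ _, hu⟩)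

/-- Every element lies below the top of its chain, which is maximal or covered from the
previous chain. -/
theorem chain_top {G : GridData P} (hG : G.IsTwoColorGridPoset) (u : P) :
    ∃ z, u ≤ z ∧ G.chain z = G.chain u ∧
      (IsMax z ∨ ∃ v, z ≤ v ∧ G.chain z = G.chain v + 1 ∧ G.color v ≠ G.color z) := by
  have hne : (Finset.univ.filter (fun z => u ≤ z ∧ G.chain z = G.chain u)).Nonempty :=
    ⟨u, by simp⟩
  obtain ⟨z, hz⟩ := Finset.exists_maximal hne
  have hz1 := hz.1
  simp only [Finset.mem_filter, Finset.mem_univ, true_and] at hz1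
  refine ⟨z, hz1.1, hz1.2, ?_⟩
  by_cases hm : IsMax z
  · exact Or.inl hm
  · right
    rw [not_isMax_iff] at hm
    obtain ⟨w, hw⟩ := hm
    let _ : LocallyFiniteOrder P := Fintype.toLocallyFiniteOrder
    obtain ⟨v, hv, -⟩ := exists_covBy_le_of_lt hw
    rcases hG.1.2.2.2.2 _ _ hv with h | h
    · exfalso
      have : v ≤ z := hz.2 (by
        simp only [Finset.mem_filter, Finset.mem_univ, true_and]
        exact ⟨hz1.1.trans hv.le, h.symm.trans hz1.2⟩) hv.le
      exact absurd hv.lt (not_lt_of_ge this)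
    · exact ⟨v, hv.le, h,
        (hG.2.2 z v (Relation.ReflTransGen.single (Or.inl hv)) h).symm⟩

/-- The sign reversing involution. -/
noncomputable def inv (G : GridData P) (t : Finset P) : Finset P :=
  G.refl (G.kap (G.topIdx t)) (fun k => if k = G.topIdx t then 1 else 0) t

theorem inv_spec {G : GridData P} (hG : G.IsTwoColorGridPoset) (hmax : G.MaxProperty)
    {M : Matrix (Fin 2) (Fin 2) ℤ} (hM : G.MStructured M) {t : Finset P} (ht : IsIdeal t)
    (hne : t ≠ Finset.univ) :
    IsIdeal (G.inv t) ∧ G.inv t ≠ Finset.univ ∧ G.inv (G.inv t) = t ∧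
      ∃ γ, G.wt (G.inv t) = G.wt t - (G.mcoord γ t + 1) • M γ := by
  obtain ⟨u, hut, hui⟩ := topIdx_exists (G := G) hne
  set i := G.topIdx t with hi
  set γ := G.kap i with hγ
  have hcu : G.color u = γ := by rw [hγ, ← hui, kap_chain hG]
  have hcol : ∀ v, G.chain v = i → G.color v = γ := fun v hv => by
    rw [hγ, ← hv, kap_chain hG]
  have hfull : ∀ v, i < G.chain v → v ∈ t := fun v hv => topIdx_full hv
  set e : ℕ → ℕ := fun k => if k = i then 1 else 0 with he
  have hinv : G.inv t = G.refl γ e t := rfl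
  -- the chain `i` is contained in `tmax`
  have hmaxi : ∀ v, G.chain v = i → v ∈ G.tmax γ t := by
    intro v hv
    simp only [tmax, Finset.mem_filter, Finset.mem_univ, true_and]
    intro w hw hc
    apply hfull
    have := chain_anti hG.1 hw
    rcases Nat.lt_or_ge i (G.chain w) with h | h
    · exact h
    · exact absurd (hcol w (by omega)) hc
  have hlt : G.cnt i t < G.cnt i (G.tmax γ t) := by
    unfold cnt
    apply Finset.card_lt_card
    rw [Finset.ssubset_iff_of_subset (Finset.filter_subset_filter _ (sub_tmax ht))]
    exact ⟨u, by simp [hmaxi u hui, hui], by simp [hut]⟩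
  have hee : ∀ k, e k + G.cnt k t ≤ G.cnt k (G.tmax γ t) := by
    intro k
    by_cases hk : k = i
    · subst hk; simp only [he, if_true]; omega
    · simp only [he, if_neg hk, zero_add]
      exact cnt_mono G k (sub_tmax ht)
  obtain ⟨h1, h2, h3, h4⟩ := refl_spec hG ht hee
  -- chains above `i` remain full
  have hfull' : ∀ v, i < G.chain v → v ∈ G.refl γ e t := by
    intro v hv
    by_cases hc : G.color v = γ
    · have hmin : v ∈ G.tmin γ t := by
        obtain ⟨z, hz1, hz2, hz3⟩ := chain_top hG v
        have hzc : G.color z = γ := by rw [← hc]; exact hG.2.1 _ _ hz2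
        have hi1 : 1 ≤ i := by
          have := hG.1.2.1 u
          rw [Finset.mem_Icc] at this; omega
        rcases hz3 with hz3 | ⟨w, hw1, hw2, hw3⟩
        · exfalso
          have hz4 := hmax.1 z hz3
          obtain ⟨y, hy1, hy2, hy3⟩ := chain_top hG u
          have hyi : G.chain y = 1 := by omega
          rcases hy3 with hy3 | ⟨w, hw1, hw2, hw3⟩
          · apply hmax.2 z y hz3 hy3
            · rintro rfl; omega
            · rw [hzc, hcol y (by omega)]
          · have := hG.1.2.1 w
            rw [Finset.mem_Icc] at this; omega
        · simp only [tmin, Finset.mem_filter, Finset.mem_univ, true_and]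
          have hwc : G.color w ≠ γ := by rw [← hzc]; exact hw3
          refine ⟨w, hz1.trans hw1, hwc, ?_⟩
          apply hfull
          rcases Nat.lt_or_ge i (G.chain w) with h | h
          · exact h
          · exact absurd (hcol w (by omega)) hwc
      have := tmin_sub (G := G) (γ := γ) h1
      rw [tmin_congr h2] at this
      exact this hmin
    · exact (h2 v hc).2 (hfull v hv)
  have hnot : ∃ v, v ∉ G.refl γ e t ∧ G.chain v = i := by
    by_contra hcon
    push Not at hcon
    have h5 : G.cnt i (G.tmax γ t) ≤ G.cnt i (G.refl γ e t) := by
      apply Finset.card_le_card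
      intro v hv
      rw [Finset.mem_filter] at hv ⊢
      refine ⟨?_, hv.2⟩
      by_contra h
      exact hcon v h hv.2
    have h6 := h3 i
    have h7 := cnt_mono G i (tmin_sub (G := G) (γ := γ) ht)
    simp only [he, if_true] at h6 h5
    omega
  have htop : G.topIdx (G.refl γ e t) = i := topIdx_eq hnot hfull'
  refine ⟨h1, ?_, ?_, γ, ?_⟩
  · rw [hinv]
    intro h
    obtain ⟨v, hv, -⟩ := hnot
    exact hv (by rw [h]; exact Finset.mem_univ v)
  · rw [hinv]
    unfold inv
    rw [htop]
    exact h4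
  · rw [hinv, refl_wt hG hM ht hee]
    have : ∑ k ∈ Finset.range (G.m + 1), e k = 1 := by
      rw [he, Finset.sum_ite_eq', if_pos]
      have := hG.1.2.1 u
      rw [Finset.mem_Icc] at this
      rw [Finset.mem_range]; omega
    rw [this]
    simp

/-- The set of ideals. -/
noncomputable def ideals (P : Type) [PartialOrder P] [Fintype P] : Finset (Finset P) :=
  Finset.univ.filter (fun t : Finset P => IsIdeal t)

theorem mem_ideals {t : Finset P} : t ∈ ideals P ↔ IsIdeal t := by simp [ideals]

theorem wt_apply (G : GridData P) (γ : Fin 2) (t : Finset P) : G.wt t γ = G.mcoord γ t := by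
  fin_cases γ <;> rfl

theorem sum_refl {G : GridData P} (hG : G.IsTwoColorGridPoset)
    {M : Matrix (Fin 2) (Fin 2) ℤ} (hM : G.MStructured M) {R : Type} [AddCommMonoid R] (γ : Fin 2)
    (f : (Fin 2 → ℤ) → R) :
    ∑ t ∈ ideals P, f (G.wt t) = ∑ t ∈ ideals P, f (G.wt t - G.mcoord γ t • M γ) := by
  have hee : ∀ t ∈ ideals P, ∀ k, (fun _ => 0 : ℕ → ℕ) k + G.cnt k t ≤ G.cnt k (G.tmax γ t) := by
    intro t ht k
    simpa using cnt_mono G k (sub_tmax (mem_ideals.1 ht))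
  symm
  refine Finset.sum_bij' (fun t _ => G.refl γ (fun _ => 0) t) (fun t _ => G.refl γ (fun _ => 0) t)
    ?_ ?_ ?_ ?_ ?_
  · intro t ht
    exact mem_ideals.2 (refl_spec hG (mem_ideals.1 ht) (hee t ht)).1
  · intro t ht
    exact mem_ideals.2 (refl_spec hG (mem_ideals.1 ht) (hee t ht)).1
  · intro t ht
    exact (refl_spec hG (mem_ideals.1 ht) (hee t ht)).2.2.2
  · intro t ht
    exact (refl_spec hG (mem_ideals.1 ht) (hee t ht)).2.2.2
  · intro t ht
    rw [refl_wt hG hM (mem_ideals.1 ht) (hee t ht)]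
    simp

theorem sum_refl0 {G : GridData P} (hG : G.IsTwoColorGridPoset)
    (hM : G.MStructured !![2, -1; -2, 2]) {R : Type} [AddCommMonoid R] (f : ℤ → ℤ → R) :
    ∑ t ∈ ideals P, f (G.mcoord 0 t) (G.mcoord 1 t) =
      ∑ t ∈ ideals P, f (-G.mcoord 0 t) (G.mcoord 0 t + G.mcoord 1 t) := by
  have := sum_refl hG hM 0 (fun v => f (v 0) (v 1))
  simp only [Pi.sub_apply, Pi.smul_apply, wt_apply] at this
  rw [this]
  refine Finset.sum_congr rfl fun t _ => ?_
  congr 1 <;> simp <;> ring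

theorem sum_refl1 {G : GridData P} (hG : G.IsTwoColorGridPoset)
    (hM : G.MStructured !![2, -1; -2, 2]) {R : Type} [AddCommMonoid R] (f : ℤ → ℤ → R) :
    ∑ t ∈ ideals P, f (G.mcoord 0 t) (G.mcoord 1 t) =
      ∑ t ∈ ideals P, f (G.mcoord 0 t + 2 * G.mcoord 1 t) (-G.mcoord 1 t) := by
  have := sum_refl hG hM 1 (fun v => f (v 0) (v 1))
  simp only [Pi.sub_apply, Pi.smul_apply, wt_apply] at this
  rw [this]
  refine Finset.sum_congr rfl fun t _ => ?_
  congr 1 <;> simp <;> ring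

theorem sum_neg {G : GridData P} (hG : G.IsTwoColorGridPoset)
    (hM : G.MStructured !![2, -1; -2, 2]) {R : Type} [AddCommMonoid R] (f : ℤ → ℤ → R) :
    ∑ t ∈ ideals P, f (G.mcoord 0 t) (G.mcoord 1 t) =
      ∑ t ∈ ideals P, f (-G.mcoord 0 t) (-G.mcoord 1 t) := by
  rw [sum_refl0 hG hM, sum_refl1 hG hM (fun x y => f (-x) (x + y)),
    sum_refl0 hG hM (fun x y => f (-(x + 2 * y)) (x + 2 * y + -y)),
    sum_refl1 hG hM (fun x y => f (-(-x + 2 * (x + y))) (-x + 2 * (x + y) + -(x + y)))]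
  refine Finset.sum_congr rfl fun t _ => ?_
  congr 1 <;> ring

theorem empty_ideal : IsIdeal (∅ : Finset P) := by
  intro x hx; simp at hx

theorem rank_const {G : GridData P} (hM : G.MStructured !![2, -1; -2, 2]) (n : ℕ) :
    ∀ t : Finset P, IsIdeal t → t.card = n →
      3 * G.mcoord 0 t + 4 * G.mcoord 1 t = 2 * (n : ℤ) +
        (3 * G.mcoord 0 ∅ + 4 * G.mcoord 1 ∅) := by
  induction n with
  | zero =>
    intro t ht hc
    rw [Finset.card_eq_zero] at hc
    subst hc; simp
  | succ n ih =>
    intro t ht hc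
    have hne : t.Nonempty := by rw [← Finset.card_pos]; omega
    obtain ⟨u, hu⟩ := Finset.exists_maximal hne
    have hid : IsIdeal (t.erase u) := by
      intro x hx y hy
      rw [Finset.mem_erase] at hx ⊢
      refine ⟨?_, ht hx.2 hy⟩
      rintro rfl
      exact hx.1 (le_antisymm (hu.2 hx.2 hy) hy)
    have h1 := ih _ hid (by rw [Finset.card_erase_of_mem hu.1]; omega)
    have h2 := hM (t.erase u) t hid ht u (by simp) (by rw [Finset.insert_erase hu.1])
    have h3 := congrFun h2 0
    have h4 := congrFun h2 1
    simp only [Pi.add_apply, wt_apply] at h3 h4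
    push_cast
    generalize G.color u = c at h3 h4
    fin_cases c <;> simp at h3 h4 <;> linarith

theorem rank_symm {G : GridData P} (hG : G.IsTwoColorGridPoset)
    (hM : G.MStructured !![2, -1; -2, 2]) :
    (∀ t : Finset P, IsIdeal t →
      3 * G.mcoord 0 t + 4 * G.mcoord 1 t = 2 * (t.card : ℤ) - Fintype.card P) ∧
    ∀ i ≤ Fintype.card P, ((ideals P).filter (fun t => t.card = i)).card =
      ((ideals P).filter (fun t => t.card = Fintype.card P - i)).card := by
  obtain ⟨K, hK⟩ : ∃ K : ℤ, ∀ t : Finset P, IsIdeal t →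
      3 * G.mcoord 0 t + 4 * G.mcoord 1 t = 2 * (t.card : ℤ) - K :=
    ⟨-(3 * G.mcoord 0 ∅ + 4 * G.mcoord 1 ∅), fun t ht => by
      rw [rank_const hM _ t ht rfl]; ring⟩
  have key : ∀ i : ℕ, ((ideals P).filter (fun t => t.card = i)).card =
      ((ideals P).filter (fun t => (t.card : ℤ) = K - i)).card := by
    intro i
    rw [Finset.card_filter, Finset.card_filter]
    have := sum_neg hG hM (fun x y => if 3 * x + 4 * y = 2 * (i : ℤ) - K then (1 : ℕ) else 0)
    refine Eq.trans ?_ (this.trans ?_)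
    · refine Finset.sum_congr rfl fun t ht => ?_
      have := hK t (mem_ideals.1 ht)
      congr 1
      apply propext
      omega
    · refine Finset.sum_congr rfl fun t ht => ?_
      have := hK t (mem_ideals.1 ht)
      congr 1
      apply propext
      omega
  have h1 : ∃ t : Finset P, (t.card : ℤ) = K := by
    have := key 0
    have h0 : 0 < ((ideals P).filter (fun t => t.card = 0)).card :=
      Finset.card_pos.2 ⟨∅, by simp [mem_ideals, empty_ideal]⟩
    rw [this, Finset.card_pos] at h0
    obtain ⟨t, ht⟩ := h0
    exact ⟨t, by simpa using (Finset.mem_filter.1 ht).2⟩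
  have h2 : ∃ t : Finset P, (t.card : ℤ) = K - Fintype.card P := by
    have := key (Fintype.card P)
    have h0 : 0 < ((ideals P).filter (fun t => t.card = Fintype.card P)).card :=
      Finset.card_pos.2 ⟨Finset.univ, by
        simp only [Finset.mem_filter, mem_ideals, Finset.card_univ, and_true]
        intro _ _ _ _; simp⟩
    rw [this, Finset.card_pos] at h0
    obtain ⟨t, ht⟩ := h0
    exact ⟨t, by simpa using (Finset.mem_filter.1 ht).2⟩
  have hKn : K = Fintype.card P := by
    obtain ⟨t, ht⟩ := h1
    obtain ⟨s, hs⟩ := h2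
    have := Finset.card_le_univ t
    omega
  subst hKn
  refine ⟨hK, fun i hi => ?_⟩
  rw [key]
  congr 2
  funext t
  apply propext
  omega

/-! The character computation -/

open LaurentPolynomial in
/-- The specialised Weyl alternant. -/
noncomputable def alt (x y : ℤ) : LaurentPolynomial ℤ :=
  T (3 * x + 4 * y) - T (x + 4 * y) - T (3 * x + 2 * y) + T (x - 2 * y) + T (-x + 2 * y)
    - T (-3 * x - 2 * y) - T (-x - 4 * y) + T (-3 * x - 4 * y)

theorem alt_refl0 (x y : ℤ) : alt x y + alt (-x) (x + y) = 0 := by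
  unfold alt
  ring_nf

theorem alt_refl1 (x y : ℤ) : alt x y + alt (x + 2 * y) (-y) = 0 := by
  unfold alt
  ring_nf

open LaurentPolynomial in
theorem alt_prod (x y : ℤ) : alt x y = T (-(3 * x + 4 * y)) *
    ((1 - T (2 * x)) * (1 - T (2 * y)) * (1 - T (2 * (x + y))) * (1 - T (2 * (x + 2 * y)))) := by
  unfold alt
  simp only [mul_sub, sub_mul, mul_one, one_mul, ← T_add]
  ring_nf

open LaurentPolynomial in
theorem char_formula {G : GridData P} (hG : G.IsTwoColorGridPoset) (hmax : G.MaxProperty)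
    (hM : G.MStructured !![2, -1; -2, 2]) :
    (∑ t ∈ ideals P, T (3 * G.mcoord 0 t + 4 * G.mcoord 1 t) : LaurentPolynomial ℤ) * alt 1 1
      = alt (G.mcoord 0 Finset.univ + 1) (G.mcoord 1 Finset.univ + 1) := by
  have r0 : ∀ p q p' c : ℤ, p' = q - p →
      (∑ t ∈ ideals P, T (p * G.mcoord 0 t + q * G.mcoord 1 t + c) : LaurentPolynomial ℤ) =
      ∑ t ∈ ideals P, T (p' * G.mcoord 0 t + q * G.mcoord 1 t + c) := by
    rintro p q p' c rfl
    rw [sum_refl0 hG hM (fun x y => (T (p * x + q * y + c) : LaurentPolynomial ℤ))]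
    refine Finset.sum_congr rfl fun t _ => ?_
    congr 1; ring
  have r1 : ∀ p q q' c : ℤ, q' = 2 * p - q →
      (∑ t ∈ ideals P, T (p * G.mcoord 0 t + q * G.mcoord 1 t + c) : LaurentPolynomial ℤ) =
      ∑ t ∈ ideals P, T (p * G.mcoord 0 t + q' * G.mcoord 1 t + c) := by
    rintro p q q' c rfl
    rw [sum_refl1 hG hM (fun x y => (T (p * x + q * y + c) : LaurentPolynomial ℤ))]
    refine Finset.sum_congr rfl fun t _ => ?_
    congr 1; ring
  have e2 := fun c => r0 3 4 1 c (by norm_num)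
  have e3 := fun c => r1 3 4 2 c (by norm_num)
  have e4 := fun c => (e2 c).trans (r1 1 4 (-2) c (by norm_num))
  have e5 := fun c => (e3 c).trans (r0 3 2 (-1) c (by norm_num))
  have e6 := fun c => (e4 c).trans (r0 1 (-2) (-3) c (by norm_num))
  have e7 := fun c => (e5 c).trans (r1 (-1) 2 (-4) c (by norm_num))
  have e8 := fun c => (e6 c).trans (r1 (-3) (-2) (-4) c (by norm_num))
  have step1 : (∑ t ∈ ideals P, T (3 * G.mcoord 0 t + 4 * G.mcoord 1 t) : LaurentPolynomial ℤ)
      * alt 1 1 = ∑ t ∈ ideals P, alt (G.mcoord 0 t + 1) (G.mcoord 1 t + 1) := by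
    unfold alt
    simp only [mul_add, mul_sub, Finset.sum_mul, ← T_add]
    simp only [e2 (1 + 4 * 1), e3 (3 * 1 + 2 * 1), e4 (1 - 2 * 1),
      e5 (-1 + 2 * 1), e6 (-3 * 1 - 2 * 1), e7 (-1 - 4 * 1), e8 (-3 * 1 - 4 * 1)]
    simp only [← Finset.sum_add_distrib, ← Finset.sum_sub_distrib]
    refine Finset.sum_congr rfl fun t _ => ?_
    ring_nf
  rw [step1]
  have huniv : (Finset.univ : Finset P) ∈ ideals P := by
    rw [mem_ideals]; intro _ _ _ _; simp
  rw [← Finset.add_sum_erase _ _ huniv]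
  have : ∑ t ∈ (ideals P).erase Finset.univ, alt (G.mcoord 0 t + 1) (G.mcoord 1 t + 1) = 0 := by
    have hsp : ∀ t ∈ (ideals P).erase Finset.univ, alt (G.mcoord 0 t + 1) (G.mcoord 1 t + 1) +
        alt (G.mcoord 0 (G.inv t) + 1) (G.mcoord 1 (G.inv t) + 1) = 0 := by
      intro t ht
      rw [Finset.mem_erase, mem_ideals] at ht
      obtain ⟨-, -, -, γ, hw⟩ := inv_spec hG hmax hM ht.2 ht.1
      have h3 := congrFun hw 0
      have h4 := congrFun hw 1
      simp only [Pi.sub_apply, Pi.smul_apply, wt_apply] at h3 h4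
      fin_cases γ
      · convert alt_refl0 _ _ using 2
        congr 1
        · rw [h3]; simp; ring
        · rw [h4]; simp; ring
      · convert alt_refl1 _ _ using 2
        congr 1
        · rw [h3]; simp; ring
        · rw [h4]; simp; ring
    refine Finset.sum_involution (fun t _ => G.inv t) hsp ?_ ?_ ?_
    · intro t ht hne heq
      have := hsp t ht
      rw [heq, ← two_mul] at this
      rcases mul_eq_zero.1 this with h | h
      · have h2 : Polynomial.toLaurent (2 : Polynomial ℤ) = Polynomial.toLaurent 0 := by
          rw [map_ofNat, map_zero]; exact h
        exact absurd (Polynomial.toLaurent_injective h2) two_ne_zero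
      · exact hne h
    · intro t ht
      rw [Finset.mem_erase, mem_ideals] at ht ⊢
      obtain ⟨h1, h2, -, -⟩ := inv_spec hG hmax hM ht.2 ht.1
      exact ⟨h2, h1⟩
    · intro t ht
      rw [Finset.mem_erase, mem_ideals] at ht
      exact (inv_spec hG hmax hM ht.2 ht.1).2.2.1
  rw [this, add_zero]

end GridData
/-- Number of partitions into at most three parts. -/
def part3 (n : ℤ) : ℤ := if n < 0 then 0 else ((n + 3) ^ 2 + 3) / 12

theorem part3_neg {n : ℤ} (h : n < 0) : part3 n = 0 := by simp [part3, h]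

theorem part3_form (k r : ℤ) (h : 0 ≤ 6 * k + r) :
    part3 (6 * k + r) = 3 * (k * k) + k * (r + 3) + ((r + 3) ^ 2 + 3) / 12 := by
  have : ¬ (6 * k + r < 0) := by omega
  rw [part3, if_neg this]
  have e : (6 * k + r + 3) ^ 2 + 3 = ((r + 3) ^ 2 + 3) + 12 * (3 * (k * k) + k * (r + 3)) := by
    ring
  rw [e, Int.add_mul_ediv_left _ _ (by norm_num)]
  ring

theorem part3_nonneg (n : ℤ) : 0 ≤ part3 n := by
  unfold part3
  split_ifs
  · rfl
  · positivity

theorem part3_small : part3 0 = 1 ∧ part3 1 = 1 ∧ part3 2 = 2 ∧ part3 3 = 3 ∧ part3 4 = 4 ∧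
    part3 5 = 5 := by
  refine ⟨?_, ?_, ?_, ?_, ?_, ?_⟩ <;> norm_num [part3]

/-- The sixth difference step. -/
theorem part3_six (n : ℤ) : part3 n - part3 (n - 6) = if n < 0 then 0 else if n = 0 then 1 else n := by
  split_ifs with h h'
  · rw [part3_neg h, part3_neg (by omega)]; rfl
  · subst h'; norm_num [part3]
  · rcases lt_or_ge n 6 with h6 | h6
    · rw [part3_neg (n := n - 6) (by omega)]
      obtain ⟨_, _, _, _, _, _⟩ := part3_small
      have : n = 1 ∨ n = 2 ∨ n = 3 ∨ n = 4 ∨ n = 5 := by omega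
      rcases this with rfl | rfl | rfl | rfl | rfl <;> linarith
    · have e1 : part3 n = part3 (6 * (1 : ℤ) + (n - 6)) := by congr 1; ring
      rw [e1, part3_form 1 (n - 6) (by omega)]
      have e2 := part3_form 0 (n - 6) (by omega)
      simp only [mul_zero, zero_add, zero_mul] at e2
      rw [e2]
      ring

theorem part3_three (n : ℤ) : part3 n - part3 (n - 3) = if n < 0 then 0 else n / 2 + 1 := by
  split_ifs with h
  · rw [part3_neg h, part3_neg (by omega)]; rfl
  · rcases lt_or_ge n 3 with h6 | h6
    · rw [part3_neg (n := n - 3) (by omega)]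
      obtain ⟨_, _, _, _, _, _⟩ := part3_small
      have : n = 0 ∨ n = 1 ∨ n = 2 := by omega
      rcases this with rfl | rfl | rfl <;> norm_num <;> linarith
    · obtain ⟨k, r, hr0, hr1, rfl⟩ : ∃ k r : ℤ, 0 ≤ r ∧ r < 6 ∧ n = 6 * k + r :=
        ⟨n / 6, n % 6, by omega, by omega, by omega⟩
      have e1 := part3_form k r (by omega)
      have e2 := part3_form k (r - 3) (by omega)
      have e3 : 6 * k + r - 3 = 6 * k + (r - 3) := by ring
      rw [e3, e1, e2]
      have : r = 0 ∨ r = 1 ∨ r = 2 ∨ r = 3 ∨ r = 4 ∨ r = 5 := by omega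
      rcases this with rfl | rfl | rfl | rfl | rfl | rfl <;> norm_num <;> omega

theorem part3_two (n : ℤ) : part3 n - part3 (n - 2) = if n < 0 then 0 else n / 3 + 1 := by
  split_ifs with h
  · rw [part3_neg h, part3_neg (by omega)]; rfl
  · rcases lt_or_ge n 2 with h6 | h6
    · rw [part3_neg (n := n - 2) (by omega)]
      obtain ⟨_, _, _, _, _, _⟩ := part3_small
      have : n = 0 ∨ n = 1 := by omega
      rcases this with rfl | rfl <;> norm_num <;> linarith
    · obtain ⟨k, r, hr0, hr1, rfl⟩ : ∃ k r : ℤ, 0 ≤ r ∧ r < 6 ∧ n = 6 * k + r :=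
        ⟨n / 6, n % 6, by omega, by omega, by omega⟩
      have e1 := part3_form k r (by omega)
      have e2 := part3_form k (r - 2) (by omega)
      have e3 : 6 * k + r - 2 = 6 * k + (r - 2) := by ring
      rw [e3, e1, e2]
      have : r = 0 ∨ r = 1 ∨ r = 2 ∨ r = 3 ∨ r = 4 ∨ r = 5 := by omega
      rcases this with rfl | rfl | rfl | rfl | rfl | rfl <;> norm_num <;> omega

/-- The coefficients of `(1 - q) RGF` up to the middle. -/
def halfc (A B n : ℤ) : ℤ :=
  part3 n - part3 (n - A) - part3 (n - B) + part3 (n - 2 * A - B) + part3 (n - A - 3 * B)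

theorem halfc_stepB (A B n : ℤ) (hA : 1 ≤ A) (hB : 3 ≤ B) (hn : 2 * n ≤ 3 * A + 4 * B - 7) :
    halfc A (B - 3) (n - 6) ≤ halfc A B n := by
  unfold halfc
  have h1 := part3_six n
  have h2 := part3_six (n - A)
  have h3 := part3_three (n - B)
  have h4 := part3_three (n - 2 * A - B)
  have h5 := part3_three (n - A - 3 * B + 3)
  have e1 : n - 6 - A = n - A - 6 := by ring
  have e2 : n - 6 - (B - 3) = n - B - 3 := by ring
  have e3 : n - 6 - 2 * A - (B - 3) = n - 2 * A - B - 3 := by ring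
  have e4 : n - 6 - A - 3 * (B - 3) = n - A - 3 * B + 3 := by ring
  have e5 : n - A - 3 * B + 3 - 3 = n - A - 3 * B := by ring
  rw [e5] at h5
  rw [e4, e1, e2, e3]
  generalize part3 n = x1 at *
  generalize part3 (n - 6) = x2 at *
  generalize part3 (n - A) = x3 at *
  generalize part3 (n - A - 6) = x4 at *
  generalize part3 (n - B) = x5 at *
  generalize part3 (n - B - 3) = x6 at *
  generalize part3 (n - 2 * A - B) = x7 at *
  generalize part3 (n - 2 * A - B - 3) = x8 at *
  generalize part3 (n - A - 3 * B) = x9 at *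
  generalize part3 (n - A - 3 * B + 3) = x10 at *
  omega

theorem halfc_stepA (A B n : ℤ) (hA : 4 ≤ A) (hB : 1 ≤ B) (hB2 : B ≤ 2)
    (hn : 2 * n ≤ 3 * A + 4 * B - 7) :
    halfc (A - 4) B (n - 6) ≤ halfc A B n := by
  unfold halfc
  have h1 := part3_six n
  have h2 := part3_two (n - A)
  have h3 := part3_six (n - B)
  have h4 := part3_two (n - 2 * A - B + 2)
  have h5 := part3_two (n - A - 3 * B)
  have e1 : n - 6 - (A - 4) = n - A - 2 := by ring
  have e2 : n - 6 - B = n - B - 6 := by ring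
  have e3 : n - 6 - 2 * (A - 4) - B = n - 2 * A - B + 2 := by ring
  have e4 : n - 6 - (A - 4) - 3 * B = n - A - 3 * B - 2 := by ring
  have e5 : n - 2 * A - B + 2 - 2 = n - 2 * A - B := by ring
  rw [e5] at h4
  rw [e4, e1, e2, e3]
  generalize part3 n = x1 at *
  generalize part3 (n - 6) = x2 at *
  generalize part3 (n - A) = x3 at *
  generalize part3 (n - A - 2) = x4 at *
  generalize part3 (n - B) = x5 at *
  generalize part3 (n - B - 6) = x6 at *
  generalize part3 (n - 2 * A - B) = x7 at *
  generalize part3 (n - 2 * A - B + 2) = x8 at *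
  generalize part3 (n - A - 3 * B) = x9 at *
  generalize part3 (n - A - 3 * B - 2) = x10 at *
  omega

theorem halfc_nonneg (N : ℕ) : ∀ A B n : ℤ, 0 ≤ A → 0 ≤ B → A + B ≤ N →
    2 * n ≤ 3 * A + 4 * B - 7 → 0 ≤ halfc A B n := by
  induction N using Nat.strong_induction_on with
  | _ N ih =>
    intro A B n hA hB hN hn
    by_cases hA0 : A = 0
    · subst hA0
      unfold halfc
      have h1 := part3_nonneg (n - 3 * B)
      have e1 : n - 2 * 0 - B = n - B := by ring
      have e2 : n - 0 - 3 * B = n - 3 * B := by ring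
      rw [e1, e2, sub_zero]; linarith
    by_cases hB0 : B = 0
    · subst hB0
      unfold halfc
      have h1 := part3_nonneg (n - 2 * A)
      have e1 : n - 2 * A - 0 = n - 2 * A := by ring
      have e2 : n - A - 3 * 0 = n - A := by ring
      rw [e1, e2, sub_zero]; linarith
    by_cases hB3 : 3 ≤ B
    · exact (ih (N - 3) (by omega) A (B - 3) (n - 6) hA (by omega) (by omega) (by omega)).trans
        (halfc_stepB A B n (by omega) hB3 hn)
    by_cases hA4 : 4 ≤ A
    · exact (ih (N - 4) (by omega) (A - 4) B (n - 6) (by omega) hB (by omega) (by omega)).trans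
        (halfc_stepA A B n hA4 (by omega) (by omega) hn)
    rcases lt_or_ge n 0 with hn0 | hn0
    · unfold halfc
      rw [part3_neg hn0, part3_neg (by omega), part3_neg (by omega), part3_neg (by omega),
        part3_neg (by omega)]
      norm_num
    · have : n ≤ 5 := by omega
      have hA3 : A ≤ 3 := by omega
      have hA1 : 1 ≤ A := by omega
      have hB1 : 1 ≤ B := by omega
      have hB2 : B ≤ 2 := by omega
      clear ih
      interval_cases A <;> interval_cases B <;> interval_cases n <;>
        first
        | (exfalso; omega)
        | norm_num [halfc, part3]

open PowerSeries in
theorem part3_series : (PowerSeries.mk (fun n : ℕ => part3 n)) * (1 - X ^ 3) * (1 - X ^ 2) * (1 - X)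
    = (1 : PowerSeries ℤ) := by
  have h3 : (PowerSeries.mk (fun n : ℕ => part3 n)) * (1 - X ^ 3)
      = PowerSeries.mk (fun n : ℕ => (n : ℤ) / 2 + 1) := by
    ext n
    rw [mul_sub, mul_one, map_sub, coeff_mul_X_pow', coeff_mk]
    simp only [coeff_mk]
    have := part3_three n
    rw [if_neg (by omega)] at this
    rw [← this]
    split_ifs with h
    · push_cast [h]; rfl
    · rw [part3_neg (n := (n : ℤ) - 3) (by omega)]
  have h2 : (PowerSeries.mk (fun n : ℕ => (n : ℤ) / 2 + 1)) * (1 - X ^ 2)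
      = PowerSeries.mk (fun _ : ℕ => (1 : ℤ)) := by
    ext n
    rw [mul_sub, mul_one, map_sub, coeff_mul_X_pow']
    simp only [coeff_mk]
    split_ifs with h
    · omega
    · omega
  have h1 : (PowerSeries.mk (fun _ : ℕ => (1 : ℤ))) * (1 - X) = 1 := by
    ext n
    rw [mul_sub, mul_one, map_sub, ← pow_one X, coeff_mul_X_pow', coeff_mk, coeff_one]
    rcases Nat.eq_zero_or_pos n with rfl | h
    · simp
    · rw [if_pos (by omega), if_neg (by omega), coeff_mk]; norm_num
  rw [h3, h2, h1]

open Polynomial in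
theorem coeff_step {p : ℤ[X]} {A B : ℕ} (hA : 1 ≤ A) (hB : 1 ≤ B)
    (h : p * ((1 : ℤ[X]) - X) * (1 - X) * (1 - X ^ 2) * (1 - X ^ 3) =
      ((1 : ℤ[X]) - X ^ A) * (1 - X ^ B) * (1 - X ^ (A + B)) * (1 - X ^ (A + 2 * B)))
    (j : ℕ) (hj : 2 * (j + 1) + 7 ≤ 3 * A + 4 * B) : p.coeff j ≤ p.coeff (j + 1) := by
  have e1 : (p * (1 - X)) * ((1 - X ^ 3) * (1 - X ^ 2) * (1 - X)) =
      1 - X ^ A - X ^ B + X ^ (2 * A + B) + X ^ (A + 3 * B) - X ^ (2 * A + 4 * B)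
        - X ^ (3 * A + 3 * B) + X ^ (3 * A + 4 * B) := by
    calc _ = p * ((1 : ℤ[X]) - X) * (1 - X) * (1 - X ^ 2) * (1 - X ^ 3) := by ring
      _ = _ := by rw [h]; ring
  have e2 := congrArg (fun q : ℤ[X] => (q : PowerSeries ℤ)) e1
  simp only [Polynomial.coe_mul, Polynomial.coe_sub, Polynomial.coe_add, Polynomial.coe_one,
    Polynomial.coe_pow, Polynomial.coe_X] at e2
  have e3 : ((p : PowerSeries ℤ) * (1 - PowerSeries.X)) =
      (1 - PowerSeries.X ^ A - PowerSeries.X ^ B + PowerSeries.X ^ (2 * A + B)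
        + PowerSeries.X ^ (A + 3 * B) - PowerSeries.X ^ (2 * A + 4 * B)
        - PowerSeries.X ^ (3 * A + 3 * B) + PowerSeries.X ^ (3 * A + 4 * B)) *
        PowerSeries.mk (fun n : ℕ => part3 n) := by
    rw [← e2]
    linear_combination (-(p : PowerSeries ℤ) * (1 - PowerSeries.X)) * part3_series
  have hc : ∀ k : ℕ, PowerSeries.coeff (j + 1) (PowerSeries.X ^ k *
      PowerSeries.mk (fun n : ℕ => part3 n)) = part3 ((j + 1 : ℕ) - (k : ℤ)) := by
    intro k
    rw [PowerSeries.coeff_X_pow_mul']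
    split_ifs with h
    · rw [PowerSeries.coeff_mk]; push_cast [h]; rfl
    · rw [part3_neg (by omega)]
  have e4 := congrArg (PowerSeries.coeff (j + 1)) e3
  simp only [add_mul, sub_mul, one_mul, map_add, map_sub, hc, mul_sub, mul_one] at e4
  rw [PowerSeries.coeff_succ_mul_X, PowerSeries.coeff_mk, Polynomial.coeff_coe,
    Polynomial.coeff_coe] at e4
  rw [part3_neg (n := ((j + 1 : ℕ) : ℤ) - ((2 * A + 4 * B : ℕ) : ℤ)) (by omega),
    part3_neg (n := ((j + 1 : ℕ) : ℤ) - ((3 * A + 3 * B : ℕ) : ℤ)) (by omega),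
    part3_neg (n := ((j + 1 : ℕ) : ℤ) - ((3 * A + 4 * B : ℕ) : ℤ)) (by omega)] at e4
  have h5 := halfc_nonneg (A + B) A B (j + 1 : ℕ) (by omega) (by omega) (by omega) (by omega)
  unfold halfc at h5
  have f1 : ((j + 1 : ℕ) : ℤ) - ((2 * A + B : ℕ) : ℤ) = ((j + 1 : ℕ) : ℤ) - 2 * A - B := by
    push_cast; ring
  have f2 : ((j + 1 : ℕ) : ℤ) - ((A + 3 * B : ℕ) : ℤ) = ((j + 1 : ℕ) : ℤ) - A - 3 * B := by
    push_cast; ring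
  rw [f1, f2] at e4
  linarith

open Polynomial in
theorem stmt_6 {P : Type} [PartialOrder P] [Fintype P] (G : GridData P)
    (hG : G.IsTwoColorGridPoset) (hmax : G.MaxProperty)
    (hM : G.MStructured !![2, -1; -2, 2])
    (a b : ℤ) (ha : a = G.wt Finset.univ 0) (hb : b = G.wt Finset.univ 1) :
    0 ≤ a ∧ 0 ≤ b ∧ PolySymmetric (RGF P) ∧ PolyUnimodal (RGF P) ∧
      RGF P * ((1 : ℤ[X]) - X) * (1 - X) * (1 - X ^ 2) * (1 - X ^ 3) = ((1 : ℤ[X]) - X ^ (a + 1).toNat) * (1 - X ^ (b + 1).toNat) * (1 - X ^ (a + b + 2).toNat) * (1 - X ^ (a + 2 * b + 3).toNat) := by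
  have hR : RGF P = ∑ t ∈ GridData.ideals P, X ^ t.card := rfl
  have hcoeff : ∀ i, (RGF P).coeff i =
      (((GridData.ideals P).filter (fun t => t.card = i)).card : ℤ) := by
    intro i
    rw [hR, Polynomial.finsetSum_coeff, Finset.card_filter]
    push_cast
    refine Finset.sum_congr rfl fun t _ => ?_
    rw [Polynomial.coeff_X_pow]
    simp only [eq_comm]
  obtain ⟨hrank, hsymm⟩ := GridData.rank_symm hG hM
  have huniv : IsIdeal (Finset.univ : Finset P) := by intro _ _ _ _; simp
  set n := Fintype.card P with hn
  have hs : ∀ i ≤ n, (RGF P).coeff i = (RGF P).coeff (n - i) := by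
    intro i hi
    rw [hcoeff, hcoeff, hsymm i hi]
  have hdeg : (RGF P).natDegree = n := by
    apply Polynomial.natDegree_eq_of_le_of_coeff_ne_zero
    · rw [Polynomial.natDegree_le_iff_coeff_eq_zero]
      intro N hN
      rw [hcoeff, Nat.cast_eq_zero, Finset.card_eq_zero, Finset.filter_eq_empty_iff]
      intro t _ h
      have := Finset.card_le_univ t
      omega
    · rw [hcoeff, Nat.cast_ne_zero, Finset.card_ne_zero]
      exact ⟨Finset.univ, by simp [GridData.mem_ideals, huniv, hn]⟩
  rw [GridData.wt_apply] at ha hb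
  have hnonneg : ∀ γ, 0 ≤ G.mcoord γ Finset.univ := by
    intro γ
    rw [GridData.mcoord_eq huniv]
    have h1 := Finset.card_le_univ (G.tmin γ Finset.univ)
    have h2 := Finset.card_le_univ (G.tmax γ Finset.univ)
    rw [Finset.card_univ]
    omega
  have ha0 : 0 ≤ a := by rw [ha]; exact hnonneg 0
  have hb0 : 0 ≤ b := by rw [hb]; exact hnonneg 1
  have hnab : (n : ℤ) = 3 * a + 4 * b := by
    have := hrank Finset.univ huniv
    rw [← ha, ← hb, Finset.card_univ] at this
    omega
  have hform : RGF P * ((1 : ℤ[X]) - X) * (1 - X) * (1 - X ^ 2) * (1 - X ^ 3) = ((1 : ℤ[X]) - X ^ (a + 1).toNat) * (1 - X ^ (b + 1).toNat) * (1 - X ^ (a + b + 2).toNat) * (1 - X ^ (a + 2 * b + 3).toNat) := by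
    have hchar := GridData.char_formula hG hmax hM
    rw [← ha, ← hb, GridData.alt_prod, GridData.alt_prod] at hchar
    apply Polynomial.expand_injective (R := ℤ) (n := 2) (by norm_num)
    apply Polynomial.toLaurent_injective
    have hX : ∀ k : ℕ, Polynomial.toLaurent (Polynomial.expand ℤ 2 (X ^ k)) =
        (LaurentPolynomial.T (2 * (k : ℤ)) : LaurentPolynomial ℤ) := by
      intro k
      rw [map_pow, Polynomial.expand_X, ← pow_mul, Polynomial.toLaurent_X_pow]
      push_cast; rfl
    have hX1 : Polynomial.toLaurent (Polynomial.expand ℤ 2 X) =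
        (LaurentPolynomial.T 2 : LaurentPolynomial ℤ) := by
      simpa only [pow_one, Nat.cast_one, mul_one] using hX 1
    have hRT : Polynomial.toLaurent (Polynomial.expand ℤ 2 (RGF P)) =
        LaurentPolynomial.T (n : ℤ) * ∑ t ∈ GridData.ideals P,
          (LaurentPolynomial.T (3 * G.mcoord 0 t + 4 * G.mcoord 1 t) : LaurentPolynomial ℤ) := by
      rw [hR, map_sum, map_sum, Finset.mul_sum]
      refine Finset.sum_congr rfl fun t ht => ?_
      rw [hX, ← LaurentPolynomial.T_add, hrank t (GridData.mem_ideals.1 ht)]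
      congr 1; ring
    simp only [map_mul, map_sub, map_one, hX, hX1, hRT]
    rw [Int.toNat_of_nonneg (by omega), Int.toNat_of_nonneg (by omega),
      Int.toNat_of_nonneg (by omega), Int.toNat_of_nonneg (by omega)]
    have c1 : (LaurentPolynomial.T (n + 7 : ℤ) : LaurentPolynomial ℤ) *
        LaurentPolynomial.T (-(3 * (a + 1) + 4 * (b + 1))) = 1 := by
      rw [← LaurentPolynomial.T_add, hnab]
      ring_nf
      exact LaurentPolynomial.T_zero
    have c2 : (LaurentPolynomial.T (n : ℤ) : LaurentPolynomial ℤ) =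
        LaurentPolynomial.T (n + 7 : ℤ) * LaurentPolynomial.T (-(3 * 1 + 4 * 1)) := by
      rw [← LaurentPolynomial.T_add]
      congr 1; ring
    rw [c2]
    have f1 : a + 1 + (b + 1) = a + b + 2 := by ring
    have f2 : a + 1 + 2 * (b + 1) = a + 2 * b + 3 := by ring
    rw [f1, f2] at hchar
    have g1 : (2 * 1 : ℤ) = 2 := by norm_num
    have g2 : (2 * (1 + 1) : ℤ) = 2 * ((2 : ℕ) : ℤ) := by norm_num
    have g3 : (2 * (1 + 2) : ℤ) = 2 * ((3 : ℕ) : ℤ) := by norm_num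
    rw [g1, g2, g3] at hchar
    linear_combination LaurentPolynomial.T (n + 7 : ℤ) * hchar +
      (1 - LaurentPolynomial.T (2 * (a + 1))) * (1 - LaurentPolynomial.T (2 * (b + 1))) *
        (1 - LaurentPolynomial.T (2 * (a + b + 2))) *
        (1 - LaurentPolynomial.T (2 * (a + 2 * b + 3))) * c1
  refine ⟨ha0, hb0, ?_, ?_, hform⟩
  · intro i hi
    rw [hdeg] at hi ⊢
    exact hs i hi
  · have hstep : ∀ j, j + 1 ≤ n / 2 → (RGF P).coeff j ≤ (RGF P).coeff (j + 1) := by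
      intro j hj
      have g1 : (a + b + 2).toNat = (a + 1).toNat + (b + 1).toNat := by omega
      have g2 : (a + 2 * b + 3).toNat = (a + 1).toNat + 2 * (b + 1).toNat := by omega
      rw [g1, g2] at hform
      exact coeff_step (by omega) (by omega) hform j (by omega)
    have hmono : ∀ i j, i ≤ j → j ≤ n / 2 → (RGF P).coeff i ≤ (RGF P).coeff j := by
      intro i j hij
      induction hij with
      | refl => intro _; rfl
      | @step k _ ih =>
        intro hk
        exact (ih (by omega)).trans (hstep k hk)
    refine ⟨n / 2, hmono, ?_⟩
    intro i j hi hij hj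
    rw [hdeg] at hj
    rcases hij.eq_or_lt with rfl | hlt
    · rfl
    · by_cases h : n - i ≤ n / 2
      · rw [hs i (by omega), hs j hj]
        exact hmono _ _ (by omega) h
      · rw [hs j hj]
        exact hmono _ _ (by omega) (by omega)
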